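/- The map Θ ↦ m_Θ is continuous and monotone non-increasing on (0,∞); in particular, for all 0 < Θ₁ ≤ Θ₂ one has m_{Θ₁} ≥ m_{Θ₂}. -/

import Mathlib

noncomputable section

open MeasureTheory Real Filter

namespace Waveguide

/-- A point of the waveguide `ℝ³ × 𝕋`, modelled as `ℝ³ × ℝ` with functions that are
`2π`-periodic in the second coordinate. -/
abbrev Pt : Type := (Fin 3 → ℝ) × ℝ

/-- The fundamental domain `ℝ³ × (0, 2π]` of the waveguide `ℝ³ × 𝕋`. -/
def Dom : Set Pt := Set.univ ×ˢ Set.Ioc 0 (2 * π)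

/-- `2π`-periodicity in the `y` variable. -/
def PeriodicY (u : Pt → ℝ) : Prop := ∀ x y, u (x, y + 2 * π) = u (x, y)

/-- The `i`-th horizontal coordinate direction. -/
def ex (i : Fin 3) : Pt := (fun j => if j = i then 1 else 0, 0)

/-- The vertical (periodic) direction. -/
def ey : Pt := (0, 1)

/-- `i`-th partial derivative in the `x` variables. -/
def gradx (u : Pt → ℝ) (p : Pt) (i : Fin 3) : ℝ := fderiv ℝ u p (ex i)

/-- Partial derivative in the `y` variable, `u_y`. -/
def grady (u : Pt → ℝ) (p : Pt) : ℝ := fderiv ℝ u p ey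

/-- `|∇_x u|²`. -/
def gradSqX (u : Pt → ℝ) (p : Pt) : ℝ := ∑ i, (gradx u p i) ^ 2

/-- `|∇_{x,y} u|²`. -/
def gradSq (u : Pt → ℝ) (p : Pt) : ℝ := gradSqX u p + (grady u p) ^ 2

/-- Membership in (a regular repesentative of) `H¹(ℝ³ × 𝕋)`, for real valued functions. -/
structure H1 (u : Pt → ℝ) : Prop where
  periodic : PeriodicY u
  diff : Differentiable ℝ u
  memL2 : IntegrableOn (fun p => (u p) ^ 2) Dom
  memGrad : IntegrableOn (fun p => gradSq u p) Dom
  memL4 : IntegrableOn (fun p => (u p) ^ 4) Dom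

/-- The `L²(ℝ³ × 𝕋)` norm. -/
def l2 (u : Pt → ℝ) : ℝ := Real.sqrt (∫ p in Dom, (u p) ^ 2)

/-- `u ∈ S_Θ`. -/
def inS (Θ : ℝ) (u : Pt → ℝ) : Prop := H1 u ∧ l2 u = Θ

/-- The nonlinear density `u⁴ + 2u²v² + v⁴`. -/
def nonlin (u v : Pt → ℝ) (p : Pt) : ℝ :=
  (u p) ^ 4 + 2 * (u p) ^ 2 * (v p) ^ 2 + (v p) ^ 4

/-- The energy functional `I(u,v)`. -/
def energy (u v : Pt → ℝ) : ℝ :=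
  (1 / 2) * (∫ p in Dom, (gradSq u p + gradSq v p))
    - (1 / 4) * ∫ p in Dom, nonlin u v p

/-- The semivirial functional `Q(u,v)`. -/
def svirial (u v : Pt → ℝ) : ℝ :=
  (∫ p in Dom, (gradSqX u p + gradSqX v p))
    - (3 / 4) * ∫ p in Dom, nonlin u v p

/-- The ground-state level `m_Θ`. -/
def mlevel (Θ : ℝ) : ℝ :=
  sInf {c | ∃ u v : Pt → ℝ, inS Θ u ∧ inS Θ v ∧ svirial u v = 0 ∧ energy u v = c}

/-- `(u,v)` is a minimizer of `m_Θ`: it lies in `V_Θ` and attains the infimum. -/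
def isMinimizer (Θ : ℝ) (u v : Pt → ℝ) : Prop :=
  inS Θ u ∧ inS Θ v ∧ svirial u v = 0 ∧ energy u v = mlevel Θ

/-- Smooth, compactly supported (in `x`) test function on the waveguide. -/
def TestFun (φ : Pt → ℝ) : Prop :=
  ContDiff ℝ (⊤ : ℕ∞) φ ∧ PeriodicY φ ∧
    ∃ K : Set (Fin 3 → ℝ), IsCompact K ∧ ∀ p : Pt, p.1 ∉ K → φ p = 0

/-- `u` is a weak solution of `-Δ_{x,y} u + lam u = f` on `ℝ³ × 𝕋`. -/
def WeakSol (lam : ℝ) (u f : Pt → ℝ) : Prop :=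
  ∀ φ : Pt → ℝ, TestFun φ →
    (∫ p in Dom,
        ((∑ i, gradx u p i * gradx φ p i) + grady u p * grady φ p + lam * u p * φ p))
      = ∫ p in Dom, f p * φ p

/-- The mass-preserving rescaling `u^τ(x,y) = τ^{3/2} u(τx, y)`. -/
def scaleX (τ : ℝ) (u : Pt → ℝ) : Pt → ℝ :=
  fun p => τ ^ ((3 : ℝ) / 2) * u (τ • p.1, p.2)

/-- `u` is independent of the `y` variable, i.e. `u_y = 0` (a.e.). -/
def Yindep (u : Pt → ℝ) : Prop := ∀ᵐ p : Pt ∂volume, grady u p = 0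

/-- The functional `J_μ(u,v)`. -/
def Jfun (μ : ℝ) (u v : Pt → ℝ) : ℝ :=
  (1 / 2) * (∫ p in Dom,
      (gradSqX u p + μ * (grady u p) ^ 2 + gradSqX v p + μ * (grady v p) ^ 2))
    - (1 / 4) * ∫ p in Dom, nonlin u v p

/-- The level `m_{1,μ}`. -/
def m1 (μ : ℝ) : ℝ :=
  sInf {c | ∃ u v : Pt → ℝ, inS 1 u ∧ inS 1 v ∧ svirial u v = 0 ∧ Jfun μ u v = c}

/-- `(u,v)` is a minimizer of `m_{1,μ}`. -/
def isMinimizerJ (μ : ℝ) (u v : Pt → ℝ) : Prop :=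
  inS 1 u ∧ inS 1 v ∧ svirial u v = 0 ∧ Jfun μ u v = m1 μ

/-! ### Objects on `ℝ³` -/

abbrev Pt3 : Type := Fin 3 → ℝ

def e3 (i : Fin 3) : Pt3 := fun j => if j = i then 1 else 0

def grad3 (w : Pt3 → ℝ) (x : Pt3) (i : Fin 3) : ℝ := fderiv ℝ w x (e3 i)

def gradSq3 (w : Pt3 → ℝ) (x : Pt3) : ℝ := ∑ i, (grad3 w x i) ^ 2

/-- Membership in (a regular representative of) `H¹(ℝ³)`. -/
structure H1R3 (w : Pt3 → ℝ) : Prop where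
  diff : Differentiable ℝ w
  memL2 : Integrable (fun x => (w x) ^ 2)
  memGrad : Integrable (fun x => gradSq3 w x)
  memL4 : Integrable (fun x => (w x) ^ 4)

/-- The `L²(ℝ³)` norm. -/
def l2R3 (w : Pt3 → ℝ) : ℝ := Real.sqrt (∫ x, (w x) ^ 2)

def nonlin3 (u v : Pt3 → ℝ) (x : Pt3) : ℝ :=
  (u x) ^ 4 + 2 * (u x) ^ 2 * (v x) ^ 2 + (v x) ^ 4

/-- The limit energy `Î(u,v)` on `ℝ³`. -/
def Ihat (u v : Pt3 → ℝ) : ℝ :=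
  (1 / 2) * (∫ x, (gradSq3 u x + gradSq3 v x)) - (1 / 4) * ∫ x, nonlin3 u v x

/-- The virial `Q̂(u,v)` on `ℝ³`. -/
def Qhat (u v : Pt3 → ℝ) : ℝ :=
  (∫ x, (gradSq3 u x + gradSq3 v x)) - (3 / 4) * ∫ x, nonlin3 u v x

/-- The ground-state energy `m̂_ρ` on `ℝ³`. -/
def mhat (ρ : ℝ) : ℝ :=
  sInf {c | ∃ u v : Pt3 → ℝ, H1R3 u ∧ H1R3 v ∧ l2R3 u = ρ ∧ l2R3 v = ρ ∧
    Qhat u v = 0 ∧ Ihat u v = c}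

/-! ### Integrability and elementary functionals -/

/-- The squared mass `‖u‖₂²`. -/
def mass (u : Pt → ℝ) : ℝ := ∫ p in Dom, (u p) ^ 2

/-- `‖∇_x u‖₂²`. -/
def kinX (u : Pt → ℝ) : ℝ := ∫ p in Dom, gradSqX u p

/-- `‖u_y‖₂²`. -/
def kinY (u : Pt → ℝ) : ℝ := ∫ p in Dom, (grady u p) ^ 2

/-- `‖u‖₄⁴`. -/
def quartic (u : Pt → ℝ) : ℝ := ∫ p in Dom, (u p) ^ 4

/-- The integral of the nonlinear density. -/
def coupling (u v : Pt → ℝ) : ℝ := ∫ p in Dom, nonlin u v p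

lemma gradSqX_nonneg (u : Pt → ℝ) (p : Pt) : 0 ≤ gradSqX u p :=
  Finset.sum_nonneg fun _ _ => sq_nonneg _

lemma nonlin_eq (u v : Pt → ℝ) (p : Pt) : nonlin u v p = ((u p) ^ 2 + (v p) ^ 2) ^ 2 := by
  unfold nonlin; ring

lemma measurable_gradSqX (u : Pt → ℝ) : Measurable (gradSqX u) := by
  unfold gradSqX gradx
  exact Finset.measurable_sum _ fun i _ => (measurable_fderiv_apply_const ℝ u (ex i)).pow_const 2

lemma measurable_grady (u : Pt → ℝ) : Measurable (grady u) :=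
  measurable_fderiv_apply_const ℝ u ey

lemma measurable_gradSq (u : Pt → ℝ) : Measurable (gradSq u) :=
  (measurable_gradSqX u).add ((measurable_grady u).pow_const 2)

lemma H1.integrable_gradSqX {u : Pt → ℝ} (hu : H1 u) : IntegrableOn (gradSqX u) Dom := by
  refine hu.memGrad.mono' (measurable_gradSqX u).aestronglyMeasurable (ae_of_all _ fun p => ?_)
  rw [Real.norm_of_nonneg (gradSqX_nonneg u p)]
  simp only [gradSq]
  linarith [sq_nonneg (grady u p)]

lemma H1.integrable_grady_sq {u : Pt → ℝ} (hu : H1 u) :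
    IntegrableOn (fun p => (grady u p) ^ 2) Dom := by
  refine hu.memGrad.mono' ((measurable_grady u).pow_const 2).aestronglyMeasurable
    (ae_of_all _ fun p => ?_)
  rw [Real.norm_of_nonneg (sq_nonneg _)]
  simp only [gradSq]
  linarith [gradSqX_nonneg u p]

lemma H1.integrable_nonlin {u v : Pt → ℝ} (hu : H1 u) (hv : H1 v) :
    IntegrableOn (nonlin u v) Dom := by
  have hcu := hu.diff.continuous
  have hcv := hv.diff.continuous
  refine ((hu.memL4.const_mul 2).add (hv.memL4.const_mul 2)).mono' ?_ (ae_of_all _ fun p => ?_)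
  · have : Continuous (nonlin u v) := by unfold nonlin; fun_prop
    exact this.aestronglyMeasurable
  · rw [nonlin_eq, Real.norm_of_nonneg (sq_nonneg _)]
    simp only [Pi.add_apply]
    nlinarith [sq_nonneg (u p ^ 2 - v p ^ 2)]

lemma H1.integrable_mul {u v : Pt → ℝ} (hu : H1 u) (hv : H1 v) :
    IntegrableOn (fun p => u p * v p) Dom := by
  have hcu := hu.diff.continuous
  have hcv := hv.diff.continuous
  refine (hu.memL2.add hv.memL2).mono' (hcu.mul hcv).aestronglyMeasurable
    (ae_of_all _ fun p => ?_)
  simp only [Pi.add_apply]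
  rw [Real.norm_eq_abs, abs_le]
  constructor <;> nlinarith [sq_nonneg (u p - v p), sq_nonneg (u p + v p)]

lemma kinX_nonneg (u : Pt → ℝ) : 0 ≤ kinX u := integral_nonneg fun p => gradSqX_nonneg u p

lemma kinY_nonneg (u : Pt → ℝ) : 0 ≤ kinY u := integral_nonneg fun _ => sq_nonneg _

lemma quartic_nonneg (u : Pt → ℝ) : 0 ≤ quartic u :=
  integral_nonneg fun p => by positivity

lemma inS_iff {Θ : ℝ} (hΘ : 0 < Θ) (u : Pt → ℝ) : inS Θ u ↔ H1 u ∧ mass u = Θ ^ 2 := by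
  unfold inS l2
  rw [Real.sqrt_eq_iff_mul_self_eq (integral_nonneg fun _ => sq_nonneg _) hΘ.le]
  unfold mass
  rw [← pow_two]

lemma svirial_eq {u v : Pt → ℝ} (hu : H1 u) (hv : H1 v) :
    svirial u v = kinX u + kinX v - 3 / 4 * coupling u v := by
  unfold svirial kinX coupling
  rw [integral_add hu.integrable_gradSqX hv.integrable_gradSqX]

lemma energy_eq {u v : Pt → ℝ} (hu : H1 u) (hv : H1 v) :
    energy u v = (kinX u + kinX v + (kinY u + kinY v)) / 2 - coupling u v / 4 := by
  unfold energy kinX kinY coupling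
  rw [integral_add hu.memGrad hv.memGrad]
  unfold gradSq
  rw [integral_add hu.integrable_gradSqX hu.integrable_grady_sq,
    integral_add hv.integrable_gradSqX hv.integrable_grady_sq]
  ring

lemma energy_eq_of_svirial {u v : Pt → ℝ} (hu : H1 u) (hv : H1 v) (hQ : svirial u v = 0) :
    energy u v = (kinX u + kinX v) / 6 + (kinY u + kinY v) / 2 := by
  rw [svirial_eq hu hv] at hQ
  rw [energy_eq hu hv]
  linarith

lemma coupling_pos {u v : Pt → ℝ} (hu : H1 u) (hv : H1 v) (hm : 0 < mass u) :
    0 < coupling u v := by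
  have h0 : 0 ≤ nonlin u v := fun p => by
    rw [nonlin_eq]; exact sq_nonneg _
  unfold coupling
  rw [integral_pos_iff_support_of_nonneg h0 (hu.integrable_nonlin hv)]
  unfold mass at hm
  rw [integral_pos_iff_support_of_nonneg (fun p => sq_nonneg (u p)) hu.memL2] at hm
  refine hm.trans_le (measure_mono fun p hp => ?_)
  simp only [Function.mem_support] at hp ⊢
  rw [nonlin_eq]
  positivity

/-! ### Amplitude and horizontal scaling -/

/-- The rescaling `(x, y) ↦ a u(τ x, y)`. -/
def rescale (a τ : ℝ) (u : Pt → ℝ) : Pt → ℝ := fun p => a * u (τ • p.1, p.2)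

/-- The linear map `(x, y) ↦ (τ x, y)`. -/
def dilate (τ : ℝ) : Pt →L[ℝ] Pt :=
  (τ • ContinuousLinearMap.fst ℝ (Fin 3 → ℝ) ℝ).prod (ContinuousLinearMap.snd ℝ (Fin 3 → ℝ) ℝ)

lemma dilate_apply (τ : ℝ) (p : Pt) : dilate τ p = (τ • p.1, p.2) := rfl

lemma restrict_Dom :
    (volume : Measure Pt).restrict Dom =
      (volume : Measure (Fin 3 → ℝ)).prod (volume.restrict (Set.Ioc 0 (2 * π))) := by
  unfold Dom
  rw [Measure.volume_eq_prod, ← Measure.prod_restrict, Measure.restrict_univ]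

/-- `(x, y) ↦ (τ x, y)` as a measurable equivalence. -/
def dilateEquiv (τ : ℝ) (hτ : τ ≠ 0) : Pt ≃ᵐ Pt :=
  MeasurableEquiv.prodCongr (MeasurableEquiv.smul₀ τ hτ) (MeasurableEquiv.refl ℝ)

lemma map_dilateEquiv {τ : ℝ} (hτ : 0 < τ) :
    Measure.map (dilateEquiv τ hτ.ne') ((volume : Measure Pt).restrict Dom) =
      ENNReal.ofReal ((τ ^ 3)⁻¹) • (volume : Measure Pt).restrict Dom := by
  rw [restrict_Dom]
  have h : (dilateEquiv τ hτ.ne' : Pt → Pt) = Prod.map (fun x : Fin 3 → ℝ => τ • x) id := rfl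
  rw [h, ← Measure.map_prod_map _ _ (measurable_const_smul τ) measurable_id, Measure.map_id,
    Measure.map_addHaar_smul _ hτ.ne', Measure.prod_smul_left]
  congr 2
  rw [abs_of_nonneg (by positivity)]
  simp

lemma integral_comp_dilate {τ : ℝ} (hτ : 0 < τ) (F : Pt → ℝ) :
    ∫ p in Dom, F (dilate τ p) = (τ ^ 3)⁻¹ * ∫ p in Dom, F p := by
  have h := integral_map_equiv (μ := (volume : Measure Pt).restrict Dom)
    (dilateEquiv τ hτ.ne') F
  rw [map_dilateEquiv hτ, integral_smul_measure, ENNReal.toReal_ofReal (by positivity)] at h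
  exact h.symm

lemma integrable_comp_dilate {τ : ℝ} (hτ : 0 < τ) {F : Pt → ℝ} (hF : IntegrableOn F Dom) :
    IntegrableOn (fun p => F (dilate τ p)) Dom := by
  have h := integrable_map_equiv (μ := (volume : Measure Pt).restrict Dom)
    (dilateEquiv τ hτ.ne') F
  rw [map_dilateEquiv hτ] at h
  exact h.1 (hF.smul_measure ENNReal.ofReal_ne_top)

lemma fderiv_rescale {u : Pt → ℝ} (hu : Differentiable ℝ u) (a τ : ℝ) (p w : Pt) :
    fderiv ℝ (rescale a τ u) p w = a * fderiv ℝ u (dilate τ p) (dilate τ w) := by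
  have h : HasFDerivAt (rescale a τ u) (a • (fderiv ℝ u (dilate τ p)).comp (dilate τ)) p :=
    ((hu (dilate τ p)).hasFDerivAt.comp p (dilate τ).hasFDerivAt).const_mul a
  rw [h.fderiv]
  rfl

lemma gradSqX_rescale {u : Pt → ℝ} (hu : Differentiable ℝ u) (a τ : ℝ) (p : Pt) :
    gradSqX (rescale a τ u) p = a ^ 2 * τ ^ 2 * gradSqX u (dilate τ p) := by
  unfold gradSqX gradx
  rw [Finset.mul_sum]
  refine Finset.sum_congr rfl fun i _ => ?_
  have : dilate τ (ex i) = τ • ex i := by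
    rw [dilate_apply]; ext <;> simp [ex]
  rw [fderiv_rescale hu, this, map_smul, smul_eq_mul]
  ring

lemma grady_rescale {u : Pt → ℝ} (hu : Differentiable ℝ u) (a τ : ℝ) (p : Pt) :
    grady (rescale a τ u) p = a * grady u (dilate τ p) := by
  unfold grady
  have : dilate τ ey = ey := by
    rw [dilate_apply]; ext <;> simp [ey]
  rw [fderiv_rescale hu, this]

lemma H1.rescale {u : Pt → ℝ} (hu : H1 u) (a : ℝ) {τ : ℝ} (hτ : 0 < τ) :
    H1 (rescale a τ u) where
  periodic := fun x y => by
    simp only [Waveguide.rescale]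
    rw [hu.periodic]
  diff := (hu.diff.comp (dilate τ).differentiable).const_mul a
  memL2 := by
    refine ((integrable_comp_dilate hτ hu.memL2).const_mul (a ^ 2)).congr (ae_of_all _ fun p => ?_)
    simp only [Waveguide.rescale, dilate_apply]
    ring
  memGrad := by
    refine (((integrable_comp_dilate hτ hu.integrable_gradSqX).const_mul (a ^ 2 * τ ^ 2)).add
      ((integrable_comp_dilate hτ hu.integrable_grady_sq).const_mul (a ^ 2))).congr
      (ae_of_all _ fun p => ?_)
    simp only [Pi.add_apply, gradSq]
    rw [gradSqX_rescale hu.diff, grady_rescale hu.diff]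
    ring
  memL4 := by
    refine ((integrable_comp_dilate hτ hu.memL4).const_mul (a ^ 4)).congr (ae_of_all _ fun p => ?_)
    simp only [Waveguide.rescale, dilate_apply]
    ring

lemma mass_rescale (u : Pt → ℝ) (a : ℝ) {τ : ℝ} (hτ : 0 < τ) :
    mass (rescale a τ u) = a ^ 2 * (τ ^ 3)⁻¹ * mass u := by
  unfold mass
  rw [mul_assoc, ← integral_comp_dilate hτ, ← integral_const_mul]
  simp only [rescale, dilate_apply, mul_pow]

lemma quartic_rescale (u : Pt → ℝ) (a : ℝ) {τ : ℝ} (hτ : 0 < τ) :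
    quartic (rescale a τ u) = a ^ 4 * (τ ^ 3)⁻¹ * quartic u := by
  unfold quartic
  rw [mul_assoc, ← integral_comp_dilate hτ, ← integral_const_mul]
  simp only [rescale, dilate_apply, mul_pow]

lemma coupling_rescale (u v : Pt → ℝ) (a : ℝ) {τ : ℝ} (hτ : 0 < τ) :
    coupling (rescale a τ u) (rescale a τ v) = a ^ 4 * (τ ^ 3)⁻¹ * coupling u v := by
  unfold coupling
  rw [mul_assoc, ← integral_comp_dilate hτ, ← integral_const_mul]
  refine integral_congr_ae (ae_of_all _ fun p => ?_)
  simp only [nonlin, rescale, dilate_apply]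
  ring

lemma kinX_rescale {u : Pt → ℝ} (hu : Differentiable ℝ u) (a : ℝ) {τ : ℝ} (hτ : 0 < τ) :
    kinX (rescale a τ u) = a ^ 2 * τ ^ 2 * (τ ^ 3)⁻¹ * kinX u := by
  unfold kinX
  rw [mul_assoc, ← integral_comp_dilate hτ, ← integral_const_mul]
  simp only [gradSqX_rescale hu]

lemma kinY_rescale {u : Pt → ℝ} (hu : Differentiable ℝ u) (a : ℝ) {τ : ℝ} (hτ : 0 < τ) :
    kinY (rescale a τ u) = a ^ 2 * (τ ^ 3)⁻¹ * kinY u := by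
  unfold kinY
  rw [mul_assoc, ← integral_comp_dilate hτ, ← integral_const_mul]
  simp only [grady_rescale hu, mul_pow]

/-! ### Perturbation by a multiple of a second function -/

/-- The function `u + c w`. -/
def perturb (u : Pt → ℝ) (c : ℝ) (w : Pt → ℝ) : Pt → ℝ := fun p => u p + c * w p

lemma perturb_perturb_neg (u : Pt → ℝ) (c : ℝ) (w : Pt → ℝ) :
    perturb (perturb u c w) (-c) w = u := by
  funext p; simp [perturb]

lemma fderiv_perturb {u w : Pt → ℝ} (hu : Differentiable ℝ u) (hw : Differentiable ℝ w)
    (c : ℝ) (p q : Pt) :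
    fderiv ℝ (perturb u c w) p q = fderiv ℝ u p q + c * fderiv ℝ w p q := by
  have h : HasFDerivAt (perturb u c w) (fderiv ℝ u p + c • fderiv ℝ w p) p :=
    (hu p).hasFDerivAt.add ((hw p).hasFDerivAt.const_mul c)
  rw [h.fderiv]
  rfl

lemma add_mul_sq_le {η : ℝ} (hη : 0 < η) (a b c : ℝ) :
    (a + c * b) ^ 2 ≤ (1 + η) * a ^ 2 + (1 + η⁻¹) * c ^ 2 * b ^ 2 := by
  have h : (1 + η) * a ^ 2 + (1 + η⁻¹) * c ^ 2 * b ^ 2 - (a + c * b) ^ 2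
      = η⁻¹ * (η * a - c * b) ^ 2 := by
    field_simp; ring
  have : 0 ≤ η⁻¹ * (η * a - c * b) ^ 2 := by positivity
  linarith

lemma gradSqX_perturb_le {u w : Pt → ℝ} (hu : Differentiable ℝ u) (hw : Differentiable ℝ w)
    (c : ℝ) {η : ℝ} (hη : 0 < η) (p : Pt) :
    gradSqX (perturb u c w) p ≤ (1 + η) * gradSqX u p + (1 + η⁻¹) * c ^ 2 * gradSqX w p := by
  unfold gradSqX gradx
  rw [Finset.mul_sum, Finset.mul_sum, ← Finset.sum_add_distrib]
  refine Finset.sum_le_sum fun i _ => ?_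
  rw [fderiv_perturb hu hw]
  exact add_mul_sq_le hη _ _ _

lemma grady_perturb {u w : Pt → ℝ} (hu : Differentiable ℝ u) (hw : Differentiable ℝ w)
    (c : ℝ) (p : Pt) : grady (perturb u c w) p = grady u p + c * grady w p :=
  fderiv_perturb hu hw c p ey

lemma H1.perturb {u w : Pt → ℝ} (hu : H1 u) (hw : H1 w) (c : ℝ) : H1 (perturb u c w) := by
  have hd : Differentiable ℝ (Waveguide.perturb u c w) := hu.diff.add (hw.diff.const_mul c)
  have hc := hd.continuous
  refine ⟨fun x y => ?_, hd, ?_, ?_, ?_⟩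
  · simp only [Waveguide.perturb]
    rw [hu.periodic, hw.periodic]
  · refine ((hu.memL2.const_mul (1 + 1)).add (hw.memL2.const_mul ((1 + 1⁻¹) * c ^ 2))).mono'
      (hc.pow 2).aestronglyMeasurable (ae_of_all _ fun p => ?_)
    rw [Real.norm_of_nonneg (sq_nonneg _)]
    exact add_mul_sq_le one_pos _ _ _
  · refine ((hu.memGrad.const_mul (1 + 1)).add (hw.memGrad.const_mul ((1 + 1⁻¹) * c ^ 2))).mono'
      (measurable_gradSq _).aestronglyMeasurable (ae_of_all _ fun p => ?_)
    have h1 := gradSqX_perturb_le hu.diff hw.diff c one_pos p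
    have h2 := add_mul_sq_le one_pos (grady u p) (grady w p) c
    have h3 := gradSqX_nonneg (Waveguide.perturb u c w) p
    rw [Real.norm_of_nonneg (by unfold gradSq; positivity)]
    simp only [Pi.add_apply, gradSq]
    rw [grady_perturb hu.diff hw.diff]
    linarith
  · refine ((hu.memL4.const_mul 8).add (hw.memL4.const_mul (8 * c ^ 4))).mono'
      (hc.pow 4).aestronglyMeasurable (ae_of_all _ fun p => ?_)
    rw [Real.norm_of_nonneg (by positivity)]
    have h1 := add_mul_sq_le one_pos (u p) (w p) c
    have h2 : ((u p + c * w p) ^ 2) ^ 2 ≤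
        ((1 + 1) * u p ^ 2 + (1 + 1⁻¹) * c ^ 2 * w p ^ 2) ^ 2 :=
      pow_le_pow_left₀ (sq_nonneg _) h1 2
    simp only [Pi.add_apply, Waveguide.perturb]
    nlinarith [sq_nonneg (u p ^ 2 - c ^ 2 * w p ^ 2)]

lemma kinX_perturb_le {u w : Pt → ℝ} (hu : H1 u) (hw : H1 w) (c : ℝ) {η : ℝ} (hη : 0 < η) :
    kinX (perturb u c w) ≤ (1 + η) * kinX u + (1 + η⁻¹) * c ^ 2 * kinX w := by
  unfold kinX
  rw [← integral_const_mul, ← integral_const_mul,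
    ← integral_add (hu.integrable_gradSqX.const_mul _) (hw.integrable_gradSqX.const_mul _)]
  exact integral_mono (hu.perturb hw c).integrable_gradSqX
    ((hu.integrable_gradSqX.const_mul _).add (hw.integrable_gradSqX.const_mul _))
    fun p => gradSqX_perturb_le hu.diff hw.diff c hη p

lemma le_kinX_perturb {u w : Pt → ℝ} (hu : H1 u) (hw : H1 w) (c : ℝ) {η : ℝ} (hη : 0 < η) :
    kinX u ≤ (1 + η) * kinX (perturb u c w) + (1 + η⁻¹) * c ^ 2 * kinX w := by
  have h := kinX_perturb_le (hu.perturb hw c) hw (-c) hη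
  rwa [perturb_perturb_neg, neg_sq] at h

lemma coupling_perturb_le {u v w : Pt → ℝ} (hu : H1 u) (hv : H1 v) (hw : H1 w) (c d : ℝ)
    {η : ℝ} (hη : 0 < η) :
    coupling (perturb u c w) (perturb v d w) ≤
      (1 + η) ^ 3 * coupling u v + (1 + η⁻¹) ^ 3 * (c ^ 2 + d ^ 2) ^ 2 * quartic w := by
  unfold coupling quartic
  rw [← integral_const_mul, ← integral_const_mul,
    ← integral_add ((hu.integrable_nonlin hv).const_mul _) (hw.memL4.const_mul _)]
  refine integral_mono ((hu.perturb hw c).integrable_nonlin (hv.perturb hw d))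
    (((hu.integrable_nonlin hv).const_mul _).add (hw.memL4.const_mul _)) fun p => ?_
  simp only [nonlin_eq, perturb]
  have h1 := add_mul_sq_le hη (u p) (w p) c
  have h2 := add_mul_sq_le hη (v p) (w p) d
  have h3 : (u p + c * w p) ^ 2 + (v p + d * w p) ^ 2 ≤
      ((1 + η) * (u p ^ 2 + v p ^ 2)) + 1 * ((1 + η⁻¹) * (c ^ 2 + d ^ 2) * w p ^ 2) := by
    linarith
  calc _ ≤ _ := pow_le_pow_left₀ (by positivity) h3 2
    _ ≤ _ := add_mul_sq_le hη _ _ _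
    _ = _ := by ring

lemma le_coupling_perturb {u v w : Pt → ℝ} (hu : H1 u) (hv : H1 v) (hw : H1 w) (c d : ℝ)
    {η : ℝ} (hη : 0 < η) :
    coupling u v ≤ (1 + η) ^ 3 * coupling (perturb u c w) (perturb v d w)
      + (1 + η⁻¹) ^ 3 * (c ^ 2 + d ^ 2) ^ 2 * quartic w := by
  have h := coupling_perturb_le (hu.perturb hw c) (hv.perturb hw d) hw (-c) (-d) hη
  rwa [perturb_perturb_neg, perturb_perturb_neg, neg_sq, neg_sq] at h

lemma kinY_perturb {u w : Pt → ℝ} (hu : H1 u) (hw : H1 w) (hwy : ∀ p, grady w p = 0) (c : ℝ) :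
    kinY (perturb u c w) = kinY u := by
  unfold kinY
  simp only [grady_perturb hu.diff hw.diff, hwy, mul_zero, add_zero]

lemma mass_perturb {u w : Pt → ℝ} (hu : H1 u) (hw : H1 w) (c : ℝ) :
    mass (perturb u c w) = mass u + 2 * c * (∫ p in Dom, u p * w p) + c ^ 2 * mass w := by
  have hsum : IntegrableOn (fun p => u p ^ 2 + 2 * c * (u p * w p)) Dom :=
    hu.memL2.add ((hu.integrable_mul hw).const_mul _)
  unfold mass
  rw [← integral_const_mul, ← integral_const_mul,
    ← integral_add hu.memL2 ((hu.integrable_mul hw).const_mul _),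
    ← integral_add hsum (hw.memL2.const_mul _)]
  refine integral_congr_ae (ae_of_all _ fun p => ?_)
  simp only [perturb]
  ring

/-- Adding a suitable multiple of a normalised function raises the mass to any larger level. -/
lemma exists_mass_perturb {u w : Pt → ℝ} (hu : H1 u) (hw : H1 w) (hw1 : mass w = 1) {D : ℝ}
    (hD : 0 ≤ D) : ∃ c : ℝ, c ^ 2 ≤ D ∧ mass (perturb u c w) = mass u + D := by
  set β := ∫ p in Dom, u p * w p with hβ
  have hs : Real.sqrt (β ^ 2 + D) ^ 2 = β ^ 2 + D := Real.sq_sqrt (by positivity)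
  have hs1 : |β| ≤ Real.sqrt (β ^ 2 + D) := Real.abs_le_sqrt (by linarith)
  have hmass := mass_perturb hu hw
  simp only [hw1, ← hβ] at hmass
  rcases le_total 0 β with h | h
  · rw [abs_of_nonneg h] at hs1
    refine ⟨-β + Real.sqrt (β ^ 2 + D), by nlinarith, ?_⟩
    rw [hmass]; linarith
  · rw [abs_of_nonpos h] at hs1
    refine ⟨-β - Real.sqrt (β ^ 2 + D), by nlinarith, ?_⟩
    rw [hmass]; linarith

/-! ### A profile independent of `y` -/

lemma exists_profile : ∃ g : Pt → ℝ, H1 g ∧ mass g = 1 ∧ 0 < kinX g ∧ ∀ p, grady g p = 0 := by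
  suffices h : ∃ g : Pt → ℝ, H1 g ∧ 0 < mass g ∧ 0 < kinX g ∧ ∀ p, grady g p = 0 by
    obtain ⟨g, hg, hm, hk, hy⟩ := h
    have hs : ((Real.sqrt (mass g))⁻¹) ^ 2 = (mass g)⁻¹ := by
      rw [inv_pow, Real.sq_sqrt hm.le]
    refine ⟨rescale (Real.sqrt (mass g))⁻¹ 1 g, hg.rescale _ one_pos, ?_, ?_, fun p => ?_⟩
    · rw [mass_rescale g _ one_pos, hs]
      field_simp
    · rw [kinX_rescale hg.diff _ one_pos, hs]
      positivity
    · rw [grady_rescale hg.diff, hy, mul_zero]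
  let f : ContDiffBump (0 : Fin 3 → ℝ) := ⟨1, 2, one_pos, one_lt_two⟩
  have hfd : ContDiff ℝ 1 f := f.contDiff
  have hfdiff : Differentiable ℝ f := hfd.differentiable one_ne_zero
  have hfc : Continuous f := f.continuous
  have hfs : HasCompactSupport f := f.hasCompactSupport
  set G : (Fin 3 → ℝ) → ℝ :=
    fun x => ∑ i : Fin 3, (fderiv ℝ f x (fun j => if j = i then 1 else 0)) ^ 2 with hG
  have hGc : Continuous G := by
    have h := hfd.continuous_fderiv one_ne_zero
    refine continuous_finsetSum _ fun i _ => ?_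
    exact (h.clm_apply continuous_const).pow 2
  have hGs : HasCompactSupport G := by
    refine (hfs.fderiv ℝ).comp_left
      (g := fun L : (Fin 3 → ℝ) →L[ℝ] ℝ => ∑ i : Fin 3, (L (fun j => if j = i then 1 else 0)) ^ 2)
      ?_
    simp
  have hder : ∀ p q : Pt, fderiv ℝ (fun p : Pt => f p.1) p q = fderiv ℝ f p.1 q.1 := fun p q => by
    have h : HasFDerivAt (fun p : Pt => f p.1)
        ((fderiv ℝ f p.1).comp (ContinuousLinearMap.fst ℝ (Fin 3 → ℝ) ℝ)) p :=
      (hfdiff p.1).hasFDerivAt.comp p hasFDerivAt_fst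
    rw [h.fderiv]
    rfl
  have hgx : ∀ p : Pt, gradSqX (fun p : Pt => f p.1) p = G p.1 := fun p => by
    simp only [gradSqX, gradx, hder, hG, ex]
  have hgy : ∀ p : Pt, grady (fun p : Pt => f p.1) p = 0 := fun p => by
    simp only [grady, hder, ey, map_zero]
  have hint : ∀ F : (Fin 3 → ℝ) → ℝ, Continuous F → HasCompactSupport F →
      IntegrableOn (fun p : Pt => F p.1) Dom := fun F hF hFs => by
    unfold IntegrableOn
    rw [restrict_Dom]
    exact (hF.integrable_of_hasCompactSupport hFs).comp_fst _
  have hpos : ∀ F : (Fin 3 → ℝ) → ℝ, Continuous F → HasCompactSupport F → 0 ≤ F →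
      (∃ x, F x ≠ 0) → 0 < ∫ p in Dom, F p.1 := fun F hF hFs h0 ⟨x, hx⟩ => by
    rw [restrict_Dom, integral_fun_fst]
    refine smul_pos ?_ (hF.integral_pos_of_hasCompactSupport_nonneg_nonzero hFs h0 hx)
    have hpi := Real.pi_pos
    simp only [Measure.real, Measure.restrict_apply_univ, Real.volume_Ioc, sub_zero]
    rw [ENNReal.toReal_ofReal] <;> positivity
  have hpow : ∀ n : ℕ, n ≠ 0 → HasCompactSupport (fun x => f x ^ n) := fun n hn =>
    hfs.comp_left (g := fun t : ℝ => t ^ n) (zero_pow hn)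
  have hf0 : f 0 = 1 := f.one_of_mem_closedBall (by simp [f])
  refine ⟨fun p => f p.1, ⟨fun _ _ => rfl, hfdiff.comp differentiable_fst, ?_, ?_, ?_⟩,
    ?_, ?_, hgy⟩
  · exact hint _ (hfc.pow 2) (hpow 2 two_ne_zero)
  · simp only [gradSq, hgx, hgy]
    simpa using hint G hGc hGs
  · exact hint _ (hfc.pow 4) (hpow 4 four_ne_zero)
  · exact hpos _ (hfc.pow 2) (hpow 2 two_ne_zero) (fun x => sq_nonneg (f x)) ⟨0, by simp [hf0]⟩
  · simp only [kinX, hgx]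
    refine hpos G hGc hGs (fun x => Finset.sum_nonneg fun _ _ => sq_nonneg _) ?_
    by_contra! hzero
    have hfz : ∀ x, fderiv ℝ f x = 0 := fun x => by
      have h1 := (Finset.sum_eq_zero_iff_of_nonneg fun _ _ => sq_nonneg _).1 (hzero x)
      refine ContinuousLinearMap.coe_injective ((Pi.basisFun ℝ (Fin 3)).ext fun i => ?_)
      have h2 := pow_eq_zero_iff two_ne_zero |>.1 (h1 i (Finset.mem_univ i))
      have h3 : (Pi.basisFun ℝ (Fin 3)) i = fun j => if j = i then 1 else 0 := by
        ext j; simp [Pi.single_apply]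
      rw [h3]
      simpa using h2
    have hconst := is_const_of_fderiv_eq_zero hfdiff hfz 0 (fun _ => 3)
    have hout : f (fun _ => 3) = 0 := f.zero_of_le_dist (by
      rw [dist_zero_right]
      simp only [pi_norm_const, f]
      norm_num)
    rw [hf0, hout] at hconst
    exact one_ne_zero hconst

/-! ### The level -/

/-- The set of energies of the pairs in `V_Θ`. -/
def levelSet (Θ : ℝ) : Set ℝ :=
  {c | ∃ u v : Pt → ℝ, inS Θ u ∧ inS Θ v ∧ svirial u v = 0 ∧ energy u v = c}

lemma nonneg_of_mem_levelSet {Θ e : ℝ} (he : e ∈ levelSet Θ) : 0 ≤ e := by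
  obtain ⟨u, v, hu, hv, hQ, rfl⟩ := he
  rw [energy_eq_of_svirial hu.1 hv.1 hQ]
  have := kinX_nonneg u
  have := kinX_nonneg v
  have := kinY_nonneg u
  have := kinY_nonneg v
  positivity

lemma mlevel_le_of_mem {Θ e : ℝ} (he : e ∈ levelSet Θ) : mlevel Θ ≤ e :=
  csInf_le ⟨0, fun _ h => nonneg_of_mem_levelSet h⟩ he

lemma mlevel_nonneg (Θ : ℝ) : 0 ≤ mlevel Θ :=
  Real.sInf_nonneg fun _ h => nonneg_of_mem_levelSet h

/-- Mass-preserving rescaling projects a pair onto the constraint `Q = 0`. -/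
lemma mem_levelSet_of_projection {Θ : ℝ} {u v : Pt → ℝ} (hΘ : 0 < Θ) (hu : inS Θ u)
    (hv : inS Θ v) (hX : 0 < kinX u + kinX v) :
    8 / 27 * (kinX u + kinX v) ^ 3 / coupling u v ^ 2 + (kinY u + kinY v) / 2 ∈ levelSet Θ := by
  obtain ⟨hu, hmu⟩ := (inS_iff hΘ u).1 hu
  obtain ⟨hv, hmv⟩ := (inS_iff hΘ v).1 hv
  have hN : 0 < coupling u v := coupling_pos hu hv (by rw [hmu]; positivity)
  set X := kinX u + kinX v with hXdef
  set N := coupling u v with hNdef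
  set τ := 4 * X / (3 * N) with hτdef
  have hτ : 0 < τ := by positivity
  have hτN : 3 * N * τ = 4 * X := by rw [hτdef]; field_simp
  set a := Real.sqrt (τ ^ 3) with hadef
  have ha2 : a ^ 2 = τ ^ 3 := Real.sq_sqrt (by positivity)
  have ha4 : a ^ 4 = τ ^ 6 := by
    calc a ^ 4 = (a ^ 2) ^ 2 := by ring
      _ = τ ^ 6 := by rw [ha2]; ring
  have hur := hu.rescale a hτ
  have hvr := hv.rescale a hτ
  have hQ : svirial (rescale a τ u) (rescale a τ v) = 0 := by
    rw [svirial_eq hur hvr, kinX_rescale hu.diff a hτ, kinX_rescale hv.diff a hτ,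
      coupling_rescale u v a hτ, ha2, ha4, ← mul_add, ← hXdef, ← hNdef]
    field_simp
    linear_combination -τ ^ 2 * hτN
  refine ⟨rescale a τ u, rescale a τ v, (inS_iff hΘ _).2 ⟨hur, ?_⟩, (inS_iff hΘ _).2 ⟨hvr, ?_⟩,
    hQ, ?_⟩
  · rw [mass_rescale u a hτ, ha2, hmu]; field_simp
  · rw [mass_rescale v a hτ, ha2, hmv]; field_simp
  · rw [energy_eq_of_svirial hur hvr hQ, kinX_rescale hu.diff a hτ, kinX_rescale hv.diff a hτ,
      kinY_rescale hu.diff a hτ, kinY_rescale hv.diff a hτ, ha2, ← mul_add, ← mul_add, ← hXdef,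
      hτdef]
    field_simp
    ring

lemma levelSet_nonempty {Θ : ℝ} (hΘ : 0 < Θ) : (levelSet Θ).Nonempty := by
  obtain ⟨g, hg, hm, hk, -⟩ := exists_profile
  have hS : inS Θ (rescale Θ 1 g) := (inS_iff hΘ _).2
    ⟨hg.rescale _ one_pos, by rw [mass_rescale g _ one_pos, hm]; simp⟩
  refine ⟨_, mem_levelSet_of_projection hΘ hS hS ?_⟩
  rw [kinX_rescale hg.diff _ one_pos]
  positivity

/-- Adding a small, widely spread, `y`-independent profile to both components raises the mass to
`Θ₂` and, after projection onto `Q = 0`, changes the energy by an arbitrarily small amount. -/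
lemma mlevel_le_energy {Θ₁ Θ₂ : ℝ} (h1 : 0 < Θ₁) (h12 : Θ₁ ≤ Θ₂) {u v : Pt → ℝ}
    (hu : inS Θ₁ u) (hv : inS Θ₁ v) (hQ : svirial u v = 0) : mlevel Θ₂ ≤ energy u v := by
  have h2 : 0 < Θ₂ := h1.trans_le h12
  obtain ⟨hu, hmu⟩ := (inS_iff h1 u).1 hu
  obtain ⟨hv, hmv⟩ := (inS_iff h1 v).1 hv
  have hN : 0 < coupling u v := coupling_pos hu hv (by rw [hmu]; positivity)
  obtain ⟨g, hg, hmg, -, hgy⟩ := exists_profile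
  rw [energy_eq_of_svirial hu hv hQ]
  rw [svirial_eq hu hv] at hQ
  set X := kinX u + kinX v with hXdef
  set N := coupling u v with hNdef
  have hX : X = 3 / 4 * N := by linarith
  have hXpos : 0 < X := by rw [hX]; positivity
  set D := Θ₂ ^ 2 - Θ₁ ^ 2 with hDdef
  have hD : 0 ≤ D := by nlinarith
  have hkg := kinX_nonneg g
  have hqg := quartic_nonneg g
  let Xup : ℝ → ℝ := fun η => (1 + η) * X + (1 + η) * η ^ 3 * (2 * D * kinX g)
  let Xlow : ℝ → ℝ := fun η => X - (1 + η) * η ^ 3 * (2 * D * kinX g)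
  let Nlow : ℝ → ℝ := fun η => (N - (1 + η) ^ 3 * η ^ 3 * ((2 * D) ^ 2 * quartic g)) / (1 + η) ^ 3
  have hXup : ContinuousAt Xup 0 := by fun_prop
  have hXlow : ContinuousAt Xlow 0 := by fun_prop
  have hNlow : ContinuousAt Nlow 0 :=
    ContinuousAt.div (by fun_prop) (by fun_prop) (by norm_num)
  have hXup0 : Xup 0 = X := by simp [Xup]
  have hXlow0 : Xlow 0 = X := by simp [Xlow]
  have hNlow0 : Nlow 0 = N := by simp [Nlow]
  have hlim : ContinuousAt
      (fun η => 8 / 27 * Xup η ^ 3 / Nlow η ^ 2 + (kinY u + kinY v) / 2) 0 :=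
    (((hXup.pow 3).const_mul _).div (hNlow.pow 2) (by simpa [hNlow0] using hN.ne')).add_const _
  have hlim0 : 8 / 27 * Xup 0 ^ 3 / Nlow 0 ^ 2 + (kinY u + kinY v) / 2
      = X / 6 + (kinY u + kinY v) / 2 := by
    rw [hXup0, hNlow0, hX]
    field_simp
    ring
  have htend := hlim.tendsto.mono_left (nhdsWithin_le_nhds (s := Set.Ioi (0 : ℝ)))
  simp only [hlim0] at htend
  refine ge_of_tendsto htend ?_
  have e1 : ∀ᶠ η in nhdsWithin (0 : ℝ) (Set.Ioi 0), 0 < Xlow η :=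
    nhdsWithin_le_nhds (hXlow.eventually (lt_mem_nhds (by rwa [hXlow0])))
  have e2 : ∀ᶠ η in nhdsWithin (0 : ℝ) (Set.Ioi 0), 0 < Nlow η :=
    nhdsWithin_le_nhds (hNlow.eventually (lt_mem_nhds (by rwa [hNlow0])))
  filter_upwards [e1, e2, self_mem_nhdsWithin] with η hXl hNl hη
  have hη : 0 < η := hη
  have hτ : 0 < η ^ 2 := by positivity
  set w := rescale (η ^ 3) (η ^ 2) g with hwdef
  have hw : H1 w := hg.rescale _ hτ
  have hmw : mass w = 1 := by
    rw [hwdef, mass_rescale g _ hτ, hmg]; field_simp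
  have hkw : kinX w = η ^ 4 * kinX g := by
    rw [hwdef, kinX_rescale hg.diff _ hτ]; field_simp
  have hqw : quartic w = η ^ 6 * quartic g := by
    rw [hwdef, quartic_rescale g _ hτ]; field_simp
  have hwy : ∀ p, grady w p = 0 := fun p => by
    rw [hwdef, grady_rescale hg.diff, hgy, mul_zero]
  obtain ⟨c, hc, hmc⟩ := exists_mass_perturb hu hw hmw hD
  obtain ⟨d, hd, hmd⟩ := exists_mass_perturb hv hw hmw hD
  have hcd : c ^ 2 + d ^ 2 ≤ 2 * D := by linarith
  have hcd2 : (c ^ 2 + d ^ 2) ^ 2 ≤ (2 * D) ^ 2 := pow_le_pow_left₀ (by positivity) hcd 2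
  have hSu : inS Θ₂ (perturb u c w) :=
    (inS_iff h2 _).2 ⟨hu.perturb hw c, by rw [hmc, hmu, hDdef]; ring⟩
  have hSv : inS Θ₂ (perturb v d w) :=
    (inS_iff h2 _).2 ⟨hv.perturb hw d, by rw [hmd, hmv, hDdef]; ring⟩
  have herr : (1 + η⁻¹) * (c ^ 2 + d ^ 2) * kinX w ≤ (1 + η) * η ^ 3 * (2 * D * kinX g) := by
    have : (1 + η⁻¹) * (c ^ 2 + d ^ 2) * kinX w
        = (1 + η) * η ^ 3 * ((c ^ 2 + d ^ 2) * kinX g) := by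
      rw [hkw]; field_simp; ring
    rw [this]
    gcongr
  have herr4 : (1 + η⁻¹) ^ 3 * (c ^ 2 + d ^ 2) ^ 2 * quartic w
      ≤ (1 + η) ^ 3 * η ^ 3 * ((2 * D) ^ 2 * quartic g) := by
    have : (1 + η⁻¹) ^ 3 * (c ^ 2 + d ^ 2) ^ 2 * quartic w
        = (1 + η) ^ 3 * η ^ 3 * ((c ^ 2 + d ^ 2) ^ 2 * quartic g) := by
      rw [hqw]; field_simp; ring
    rw [this]
    gcongr
  set X' := kinX (perturb u c w) + kinX (perturb v d w) with hX'
  set N' := coupling (perturb u c w) (perturb v d w) with hN'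
  have hX'up : X' ≤ Xup η := by
    have i1 := kinX_perturb_le hu hw c hη
    have i2 := kinX_perturb_le hv hw d hη
    simp only [Xup]
    rw [hX', hXdef]
    linarith
  have hX'pos : 0 < X' := by
    have i1 := le_kinX_perturb hu hw c hη
    have i2 := le_kinX_perturb hv hw d hη
    have i3 : 0 < (1 + η) * X' := by
      simp only [Xlow] at hXl
      rw [hXdef] at hXl
      rw [hX']
      linarith
    exact pos_of_mul_pos_right i3 (by positivity)
  have hN'low : Nlow η ≤ N' := by
    have i1 := le_coupling_perturb hu hv hw c d hη
    simp only [Nlow]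
    rw [div_le_iff₀ (by positivity)]
    linarith
  have hmem := mlevel_le_of_mem (mem_levelSet_of_projection h2 hSu hSv hX'pos)
  rw [kinY_perturb hu hw hwy, kinY_perturb hv hw hwy, ← hX', ← hN'] at hmem
  refine hmem.trans ?_
  gcongr

lemma mlevel_antitone {Θ₁ Θ₂ : ℝ} (h1 : 0 < Θ₁) (h12 : Θ₁ ≤ Θ₂) : mlevel Θ₂ ≤ mlevel Θ₁ := by
  refine le_csInf (levelSet_nonempty h1) ?_
  rintro _ ⟨u, v, hu, hv, hQ, rfl⟩
  exact mlevel_le_energy h1 h12 hu hv hQ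

/-- Scaling `u ↦ τ u(τ x, y)` preserves `Q = 0` and changes the mass by the factor `τ⁻¹`. -/
lemma mlevel_le_mul_mlevel {Θ₁ Θ₂ : ℝ} (h1 : 0 < Θ₁) (h12 : Θ₁ ≤ Θ₂) :
    mlevel Θ₁ ≤ (Θ₂ / Θ₁) ^ 2 * mlevel Θ₂ := by
  have h2 : 0 < Θ₂ := h1.trans_le h12
  set τ := (Θ₂ / Θ₁) ^ 2 with hτdef
  have hτ : 0 < τ := by positivity
  have hτ1 : 1 ≤ τ := one_le_pow₀ ((one_le_div h1).2 h12)
  rw [mul_comm, ← div_le_iff₀ hτ]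
  refine le_csInf (levelSet_nonempty h2) ?_
  rintro _ ⟨u, v, hu, hv, hQ, rfl⟩
  obtain ⟨hu, hmu⟩ := (inS_iff h2 u).1 hu
  obtain ⟨hv, hmv⟩ := (inS_iff h2 v).1 hv
  have hur := hu.rescale τ hτ
  have hvr := hv.rescale τ hτ
  have hQ' : svirial (rescale τ τ u) (rescale τ τ v) = 0 := by
    rw [svirial_eq hu hv] at hQ
    rw [svirial_eq hur hvr, kinX_rescale hu.diff τ hτ, kinX_rescale hv.diff τ hτ,
      coupling_rescale u v τ hτ]
    field_simp
    linear_combination 4 * τ * hQ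
  have hmass : ∀ f : Pt → ℝ, mass f = Θ₂ ^ 2 → mass (rescale τ τ f) = Θ₁ ^ 2 := fun f hf => by
    rw [mass_rescale f τ hτ, hf, hτdef]; field_simp
  have hle := mlevel_le_of_mem (Θ := Θ₁) ⟨rescale τ τ u, rescale τ τ v,
    (inS_iff h1 _).2 ⟨hur, hmass u hmu⟩, (inS_iff h1 _).2 ⟨hvr, hmass v hmv⟩, hQ', rfl⟩
  rw [energy_eq_of_svirial hur hvr hQ', kinX_rescale hu.diff τ hτ, kinX_rescale hv.diff τ hτ,
    kinY_rescale hu.diff τ hτ, kinY_rescale hv.diff τ hτ] at hle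
  rw [energy_eq_of_svirial hu hv hQ, div_le_iff₀ hτ]
  refine hle.trans ?_
  have hx : τ ^ 2 * τ ^ 2 * (τ ^ 3)⁻¹ = τ := by field_simp
  have hy : τ ^ 2 * (τ ^ 3)⁻¹ ≤ τ := by
    have : τ ^ 2 * (τ ^ 3)⁻¹ = τ⁻¹ := by field_simp
    rw [this]
    exact (inv_le_one_of_one_le₀ hτ1).trans hτ1
  rw [hx]
  have := mul_le_mul_of_nonneg_right hy (kinY_nonneg u)
  have := mul_le_mul_of_nonneg_right hy (kinY_nonneg v)
  linarith

lemma mlevel_continuousAt {Θ : ℝ} (hΘ : 0 < Θ) : ContinuousAt mlevel Θ := by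
  let lo : ℝ → ℝ := fun t => min 1 ((Θ / t) ^ 2) * mlevel Θ
  let hi : ℝ → ℝ := fun t => max 1 ((Θ / t) ^ 2) * mlevel Θ
  have hq : ContinuousAt (fun t : ℝ => (Θ / t) ^ 2) Θ :=
    (continuousAt_const.div continuousAt_id hΘ.ne').pow 2
  have hlo : Tendsto lo (nhds Θ) (nhds (mlevel Θ)) := by
    have h : ContinuousAt lo Θ := (continuousAt_const.min hq).mul continuousAt_const
    simpa [lo, ContinuousAt, hΘ.ne'] using h
  have hhi : Tendsto hi (nhds Θ) (nhds (mlevel Θ)) := by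
    have h : ContinuousAt hi Θ := (continuousAt_const.max hq).mul continuousAt_const
    simpa [hi, ContinuousAt, hΘ.ne'] using h
  have hm := mlevel_nonneg Θ
  refine tendsto_of_tendsto_of_tendsto_of_le_of_le' hlo hhi ?_ ?_
  · filter_upwards [lt_mem_nhds hΘ] with t ht
    rcases le_total t Θ with h | h
    · calc lo t ≤ 1 * mlevel Θ := mul_le_mul_of_nonneg_right (min_le_left _ _) hm
        _ ≤ mlevel t := by rw [one_mul]; exact mlevel_antitone ht h
    · calc lo t ≤ (Θ / t) ^ 2 * mlevel Θ := mul_le_mul_of_nonneg_right (min_le_right _ _) hm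
        _ ≤ (Θ / t) ^ 2 * ((t / Θ) ^ 2 * mlevel t) :=
          mul_le_mul_of_nonneg_left (mlevel_le_mul_mlevel hΘ h) (sq_nonneg _)
        _ = mlevel t := by field_simp
  · filter_upwards [lt_mem_nhds hΘ] with t ht
    rcases le_total t Θ with h | h
    · calc mlevel t ≤ (Θ / t) ^ 2 * mlevel Θ := mlevel_le_mul_mlevel ht h
        _ ≤ hi t := mul_le_mul_of_nonneg_right (le_max_right _ _) hm
    · calc mlevel t ≤ 1 * mlevel Θ := by rw [one_mul]; exact mlevel_antitone hΘ h
        _ ≤ hi t := mul_le_mul_of_nonneg_right (le_max_left _ _) hm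

/-- `Θ ↦ m_Θ` is continuous and monotone non-increasing on `(0,∞)`. -/
theorem mlevel_continuous_and_antitone :
    ContinuousOn mlevel (Set.Ioi (0 : ℝ)) ∧
    AntitoneOn mlevel (Set.Ioi (0 : ℝ)) ∧
    (∀ Θ₁ Θ₂ : ℝ, 0 < Θ₁ → Θ₁ ≤ Θ₂ → mlevel Θ₂ ≤ mlevel Θ₁) := by
  exact ⟨fun Θ hΘ => (mlevel_continuousAt hΘ).continuousWithinAt,
    fun _ h₁ _ _ h => mlevel_antitone h₁ h, fun _ _ h₁ h => mlevel_antitone h₁ h⟩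

end Waveguide
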